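/- For all n ≥ 1, the word φⁿ(2) is squarefree: it contains no nonempty factor of the form xx. -/

import Mathlib

/-- Letters: `0,1,2` represent `1,2,3`. `sigmaM` exchanges letters 1 and 2. -/
def sigmaM : Fin 3 → Fin 3
  | 0 => 1
  | 1 => 0
  | 2 => 2

/-- `rhoM` exchanges letters 2 and 3. -/
def rhoM : Fin 3 → Fin 3
  | 0 => 0
  | 1 => 2
  | 2 => 1

/-- `phi a = σ(a) · a · ρ(a)`. -/
def phi (a : List (Fin 3)) : List (Fin 3) := a.map sigmaM ++ a ++ a.map rhoM

/-- Kurosaki word `φⁿ(2)` (the letter 2 is encoded as `1 : Fin 3`). -/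
def K (n : ℕ) : List (Fin 3) := phi^[n] [1]

/-- `w` has period `p`. -/
def HasPeriod (w : List (Fin 3)) (p : ℕ) : Prop :=
  0 < p ∧ ∀ i, i + p < w.length → w[i]! = w[i + p]!

def IsLeastPeriod (w : List (Fin 3)) (p : ℕ) : Prop :=
  HasPeriod w p ∧ ∀ q, HasPeriod w q → p ≤ q

/-- every factor has exponent at most 7/4. -/
def Avoids74 (w : List (Fin 3)) : Prop :=
  ∀ x p, x <:+: w → x ≠ [] → IsLeastPeriod x p → 4 * x.length ≤ 7 * p

/-- `w` contains no nonempty factor of the form `x ++ x`. -/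
def SqFree (w : List (Fin 3)) : Prop :=
  ∀ x : List (Fin 3), x ≠ [] → ¬ (x ++ x) <:+: w

/-- the triple of `w` at positions `3k, 3k+1, 3k+2` is a permutation of `123`. -/
def TripleDistinct (w : List (Fin 3)) : Prop :=
  ∀ k, 3 * k + 2 < w.length →
    w[3 * k]! ≠ w[3 * k + 1]! ∧ w[3 * k]! ≠ w[3 * k + 2]! ∧ w[3 * k + 1]! ≠ w[3 * k + 2]!

/-- The outer permutation attached to a base-3 digit. -/
def gD (d : ℕ) (x : Fin 3) : Fin 3 :=
  if d = 0 then sigmaM x else if d = 1 then x else rhoM x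

/-- Permutation attached to the block `i` at level `n`. -/
def PP : ℕ → ℕ → Fin 3 → Fin 3
  | 0, i, x => if i % 2 = 0 then x else sigmaM x
  | n + 1, i, x => PP n (i / 3) (gD (i % 3) x)

theorem sig_sig (x : Fin 3) : sigmaM (sigmaM x) = x := by revert x; decide
theorem rho_rho (x : Fin 3) : rhoM (rhoM x) = x := by revert x; decide

theorem gD_inj (d : ℕ) : Function.Injective (gD d) := by
  intro x y h
  unfold gD at h
  split_ifs at h
  · rw [← sig_sig x, h, sig_sig]
  · exact h
  · rw [← rho_rho x, h, rho_rho]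

theorem PP_inj (n i : ℕ) : Function.Injective (PP n i) := by
  induction n generalizing i with
  | zero =>
    intro x y h
    simp only [PP] at h
    split_ifs at h
    · exact h
    · rw [← sig_sig x, h, sig_sig]
  | succ n ih =>
    intro x y h
    exact gD_inj _ (ih _ h)

theorem PP_adj (n i : ℕ) :
    (∀ x, PP n (i + 1) x = PP n i (sigmaM x)) ∨ (∀ x, PP n (i + 1) x = PP n i (rhoM x)) := by
  induction n generalizing i with
  | zero =>
    left
    intro x
    simp only [PP]
    rcases Nat.mod_two_eq_zero_or_one i with h | h
    · have h' : (i + 1) % 2 = 1 := by omega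
      simp [h, h']
    · have h' : (i + 1) % 2 = 0 := by omega
      simp [h, h', sig_sig]
  | succ n ih =>
    have hc : i % 3 = 0 ∨ i % 3 = 1 ∨ i % 3 = 2 := by omega
    simp only [PP]
    rcases hc with h | h | h
    · left
      intro x
      have h1 : (i + 1) / 3 = i / 3 := by omega
      have h2 : (i + 1) % 3 = 1 := by omega
      simp [h1, h2, h, gD, sig_sig]
    · right
      intro x
      have h1 : (i + 1) / 3 = i / 3 := by omega
      have h2 : (i + 1) % 3 = 2 := by omega
      simp [h1, h2, h, gD]
    · have h1 : (i + 1) / 3 = i / 3 + 1 := by omega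
      have h2 : (i + 1) % 3 = 0 := by omega
      rcases ih (i / 3) with hs | hr
      · right
        intro x
        simp [h1, h2, h, gD, hs, sig_sig, rho_rho]
      · left
        intro x
        simp [h1, h2, h, gD, hr]

theorem PP_top (n i : ℕ) (hi : i < 3 ^ (n + 1)) (x : Fin 3) :
    PP (n + 1) i x = gD (i / 3 ^ n) (PP n (i % 3 ^ n) x) := by
  induction n generalizing i x with
  | zero =>
    have h3 : i < 3 := by simpa using hi
    have : i / 3 = 0 := by omega
    have h4 : i % 3 = i := by omega
    simp [PP, this, h4, Nat.mod_one]
  | succ n ih =>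
    have hi' : i / 3 < 3 ^ (n + 1) := by
      rw [pow_succ] at hi
      omega
    have e : PP (n + 1 + 1) i x = PP (n + 1) (i / 3) (gD (i % 3) x) := rfl
    rw [e, ih _ hi']
    have e2 : PP (n + 1) (i % 3 ^ (n + 1)) x
      = PP n (i % 3 ^ (n + 1) / 3) (gD (i % 3 ^ (n + 1) % 3) x) := rfl
    rw [e2]
    have a1 : i / 3 / 3 ^ n = i / 3 ^ (n + 1) := by
      rw [Nat.div_div_eq_div_mul, pow_succ, mul_comm]
    have a2 : i % 3 ^ (n + 1) / 3 = i / 3 % 3 ^ n := by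
      rw [pow_succ, mul_comm, Nat.mod_mul_right_div_self]
    have a3 : i % 3 ^ (n + 1) % 3 = i % 3 :=
      Nat.mod_mod_of_dvd _ (dvd_pow_self 3 (Nat.succ_ne_zero n))
    rw [a1, a2, a3]

theorem K_succ (n : ℕ) : K (n + 1) = phi (K n) := by
  unfold K
  rw [Function.iterate_succ_apply']

theorem K_eq (n : ℕ) : K n = (List.range (3 ^ n)).map (fun i => PP n i 1) := by
  induction n with
  | zero => decide
  | succ n ih =>
    have hpos : 0 < 3 ^ n := by positivity
    have e : 3 ^ (n + 1) = 3 ^ n + 3 ^ n + 3 ^ n := by ring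
    have hlo : ∀ i, i < 3 ^ n → PP (n + 1) i 1 = sigmaM (PP n i 1) := by
      intro i hi
      rw [PP_top n i (by omega), Nat.div_eq_of_lt hi, Nat.mod_eq_of_lt hi]
      simp [gD]
    have hmi : ∀ i, i < 3 ^ n → PP (n + 1) (3 ^ n + i) 1 = PP n i 1 := by
      intro i hi
      rw [PP_top n _ (by omega), Nat.add_div_left _ hpos, Nat.add_mod_left,
        Nat.div_eq_of_lt hi, Nat.mod_eq_of_lt hi]
      simp [gD]
    have hhi : ∀ i, i < 3 ^ n → PP (n + 1) (3 ^ n + 3 ^ n + i) 1 = rhoM (PP n i 1) := by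
      intro i hi
      rw [PP_top n _ (by omega), add_assoc, Nat.add_div_left _ hpos, Nat.add_mod_left,
        Nat.add_div_left _ hpos, Nat.add_mod_left,
        Nat.div_eq_of_lt hi, Nat.mod_eq_of_lt hi]
      simp [gD]
    rw [K_succ, ih, phi, e, List.range_add, List.range_add]
    simp only [List.map_append, List.map_map]
    congr 1
    · congr 1
      · apply List.map_congr_left
        intro i hi
        exact (hlo i (List.mem_range.1 hi)).symm
      · apply List.map_congr_left
        intro i hi
        exact (hmi i (List.mem_range.1 hi)).symm
    · apply List.map_congr_left
      intro i hi
      exact (hhi i (List.mem_range.1 hi)).symm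

/-- Local word covering two consecutive blocks of length 27. -/
def vv (r : ℕ) : Fin 3 := gD (r / 9 % 3) (gD (r / 3 % 3) (gD (r % 3) 1))

def uu (b : Bool) (r : ℕ) : Fin 3 :=
  if r < 27 then vv r else if b then sigmaM (vv r) else rhoM (vv r)

theorem local_check : ∀ b : Bool, ∀ r < 27, ∀ p < 11, 0 < p →
    ∃ j < p, uu b (r + j) ≠ uu b (r + p + j) := by
  decide +kernel

theorem small_check : ∀ n < 3, ∀ s < 9, ∀ p < 5, 0 < p → s + 2 * p ≤ 3 ^ n →
    ∃ j < p, PP n (s + j) 1 ≠ PP n (s + p + j) 1 := by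
  have h0 : ∀ s < 9, ∀ p < 5, 0 < p → s + 2 * p ≤ 1 →
      ∃ j < p, PP 0 (s + j) 1 ≠ PP 0 (s + p + j) 1 := by
    intro s _ p _ hp h
    omega
  have h1 : ∀ s < 9, ∀ p < 5, 0 < p → s + 2 * p ≤ 3 →
      ∃ j < p, PP 1 (s + j) 1 ≠ PP 1 (s + p + j) 1 := by
    decide +kernel
  have h2 : ∀ s < 9, ∀ p < 5, 0 < p → s + 2 * p ≤ 9 →
      ∃ j < p, PP 2 (s + j) 1 ≠ PP 2 (s + p + j) 1 := by
    decide +kernel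
  intro n hn
  have hc : n = 0 ∨ n = 1 ∨ n = 2 := by omega
  rcases hc with rfl | rfl | rfl
  · exact h0
  · exact h1
  · exact h2

theorem PP_local (m i : ℕ) : ∃ b : Bool, ∀ r < 54, PP (m + 3) (27 * i + r) 1 = PP m i (uu b r) := by
  have key : ∀ j, PP (m + 3) j 1 = PP m (j / 27) (vv j) := by
    intro j
    have e : PP (m + 3) j 1
      = PP m (j / 3 / 3 / 3) (gD (j / 3 / 3 % 3) (gD (j / 3 % 3) (gD (j % 3) 1))) := rfl
    have h1 : j / 3 / 3 / 3 = j / 27 := by omega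
    have h2 : j / 3 / 3 = j / 9 := by omega
    rw [e, h1, h2, vv]
  have hv : ∀ r, vv (27 * i + r) = vv r := by
    intro r
    have h1 : (27 * i + r) / 9 % 3 = r / 9 % 3 := by omega
    have h2 : (27 * i + r) / 3 % 3 = r / 3 % 3 := by omega
    have h3 : (27 * i + r) % 3 = r % 3 := by omega
    rw [vv, vv, h1, h2, h3]
  rcases PP_adj m i with h | h
  · refine ⟨true, fun r hr => ?_⟩
    rw [key, hv, uu]
    split_ifs with h27
    · have : (27 * i + r) / 27 = i := by omega
      rw [this]
    · have : (27 * i + r) / 27 = i + 1 := by omega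
      rw [this, h]
    all_goals simp_all
  · refine ⟨false, fun r hr => ?_⟩
    rw [key, hv, uu]
    split_ifs with h27
    · have : (27 * i + r) / 27 = i := by omega
      rw [this]
    all_goals first | (exfalso; simp_all; done) | skip
    · have : (27 * i + r) / 27 = i + 1 := by omega
      rw [this, h]

theorem block_ne (n i : ℕ) : PP (n + 1) (3 * i) 1 ≠ PP (n + 1) (3 * i + 2) 1 := by
  intro h
  have e : ∀ j, PP (n + 1) j 1 = PP n (j / 3) (gD (j % 3) 1) := fun _ => rfl
  have h1 : 3 * i / 3 = i := by omega
  have h2 : (3 * i + 2) / 3 = i := by omega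
  have h3 : 3 * i % 3 = 0 := by omega
  have h4 : (3 * i + 2) % 3 = 2 := by omega
  rw [e, e, h1, h2, h3, h4] at h
  have := PP_inj _ _ h
  revert this
  decide

theorem mid (n i : ℕ) : PP (n + 1) (3 * i + 1) 1 = PP n i 1 := by
  have e : ∀ j, PP (n + 1) j 1 = PP n (j / 3) (gD (j % 3) 1) := fun _ => rfl
  have h2 : (3 * i + 1) / 3 = i := by omega
  have h4 : (3 * i + 1) % 3 = 1 := by omega
  rw [e, h2, h4]
  simp [gD]

theorem pal (n k : ℕ) : PP (n + 2) (9 * k + 1) 1 = PP (n + 2) (9 * k + 3) 1 ∧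
    PP (n + 2) (9 * k + 5) 1 = PP (n + 2) (9 * k + 7) 1 := by
  have e : ∀ j, PP (n + 2) j 1 = PP n (j / 3 / 3) (gD (j / 3 % 3) (gD (j % 3) 1)) := fun _ => rfl
  have key : ∀ r < 9, PP (n + 2) (9 * k + r) 1 = PP n k (gD (r / 3 % 3) (gD (r % 3) 1)) := by
    intro r hr
    have h1 : (9 * k + r) / 3 / 3 = k := by omega
    have h2 : (9 * k + r) / 3 % 3 = r / 3 % 3 := by omega
    have h3 : (9 * k + r) % 3 = r % 3 := by omega
    rw [e, h1, h2, h3]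
  rw [key 1 (by omega), key 3 (by omega), key 5 (by omega), key 7 (by omega)]
  constructor <;> congr 1

theorem main_sq (n : ℕ) : ∀ s p, 0 < p → s + 2 * p ≤ 3 ^ n →
    ¬ ∀ j < p, PP n (s + j) 1 = PP n (s + p + j) 1 := by
  induction n with
  | zero =>
    intro s p hp hs
    simp at hs
    omega
  | succ n ih =>
    intro s p hp hs hsq
    have at' : ∀ a, s ≤ a → a < s + p → PP (n + 1) a 1 = PP (n + 1) (a + p) 1 := by
      intro a h1 h2
      have := hsq (a - s) (by omega)
      rwa [show s + (a - s) = a by omega, show s + p + (a - s) = a + p by omega] at this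
    by_cases h3 : p % 3 = 0
    · obtain ⟨q, rfl⟩ : ∃ q, p = 3 * q := ⟨p / 3, by omega⟩
      rw [pow_succ] at hs
      refine ih ((s + 1) / 3) q (by omega) (by omega) fun j hj => ?_
      have := at' (3 * ((s + 1) / 3 + j) + 1) (by omega) (by omega)
      rw [mid, show 3 * ((s + 1) / 3 + j) + 1 + 3 * q = 3 * ((s + 1) / 3 + q + j) + 1 by ring,
        mid] at this
      exact this
    · by_cases hn : n + 1 < 3
      · have h9 : 3 ^ (n + 1) ≤ 9 := by
          have : n = 0 ∨ n = 1 := by omega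
          rcases this with rfl | rfl <;> norm_num
        obtain ⟨j, hj, hne⟩ := small_check (n + 1) hn s (by omega) p (by omega) hp hs
        exact hne (hsq j hj)
      · obtain ⟨m, rfl⟩ : ∃ m, n = m + 2 := ⟨n - 2, by omega⟩
        by_cases hp11 : p < 11
        · obtain ⟨b, hb⟩ := PP_local m (s / 27)
          obtain ⟨j, hj, hne⟩ := local_check b (s % 27) (by omega) p hp11 hp
          apply hne
          apply PP_inj m (s / 27)
          rw [← hb _ (by omega), ← hb _ (by omega)]
          have := hsq j hj
          rwa [show 27 * (s / 27) + (s % 27 + j) = s + j by omega,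
            show 27 * (s / 27) + (s % 27 + p + j) = s + p + j by omega]
        · by_cases h1 : p % 3 = 1
          · obtain ⟨k, hk1, hk2⟩ : ∃ k, s ≤ 9 * k + 5 ∧ 9 * k + 5 ≤ s + 8 :=
              ⟨(s + 3) / 9, by omega, by omega⟩
            have ha := at' (9 * k + 5) (by omega) (by omega)
            have hb := at' (9 * k + 7) (by omega) (by omega)
            have hc := (pal (m + 1) k).2
            apply block_ne (m + 2) ((9 * k + 5 + p) / 3)
            rw [show 3 * ((9 * k + 5 + p) / 3) = 9 * k + 5 + p by omega,
              show 9 * k + 5 + p + 2 = 9 * k + 7 + p by omega, ← ha, ← hb]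
            exact hc
          · obtain ⟨k, hk1, hk2⟩ : ∃ k, s ≤ 9 * k + 1 ∧ 9 * k + 1 ≤ s + 8 :=
              ⟨(s + 7) / 9, by omega, by omega⟩
            have ha := at' (9 * k + 1) (by omega) (by omega)
            have hb := at' (9 * k + 3) (by omega) (by omega)
            have hc := (pal (m + 1) k).1
            apply block_ne (m + 2) ((9 * k + 1 + p) / 3)
            rw [show 3 * ((9 * k + 1 + p) / 3) = 9 * k + 1 + p by omega,
              show 9 * k + 1 + p + 2 = 9 * k + 3 + p by omega, ← ha, ← hb]
            exact hc

theorem stmt3 : ∀ n : ℕ, 1 ≤ n → SqFree (K n) := by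
  intro n _ x hx ⟨a, c, h⟩
  have hxl : 0 < x.length := List.length_pos_iff.2 hx
  have hlen : (K n).length = 3 ^ n := by rw [K_eq]; simp
  have hl : a.length + 2 * x.length ≤ 3 ^ n := by
    rw [← hlen, ← h]
    simp only [List.length_append]
    omega
  have hK : ∀ i, i < 3 ^ n → (K n)[i]? = some (PP n i 1) := by
    intro i hi
    rw [K_eq]
    simp [hi]
  refine main_sq n a.length x.length hxl hl fun j hj => ?_
  have e1 := hK (a.length + j) (by omega)
  have e2 := hK (a.length + x.length + j) (by omega)
  have f1 : (K n)[a.length + j]? = x[j]? := by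
    rw [← h, List.append_assoc, List.getElem?_append_right (by omega), List.append_assoc,
      List.getElem?_append_left (by omega)]
    congr 1
    omega
  have f2 : (K n)[a.length + x.length + j]? = x[j]? := by
    rw [← h, List.append_assoc, List.getElem?_append_right (by omega), List.append_assoc,
      List.getElem?_append_right (by omega), List.getElem?_append_left (by omega)]
    congr 1
    omega
  rw [f1] at e1
  rw [f2, e1] at e2
  exact Option.some.inj e2
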